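/- Let p, q ≥ 1, let γ : {0,1}^p → {0,1} and δ : {0,1}^q → {0,1}, and let M be the (p+q+2)-feature classifier defined on instances z = (x, y, g, d) with x ∈ {0,1}^p, y ∈ {0,1}^q, g, d ∈ {0,1} (g being feature p+q+1 and d being feature p+q+2) by M(z) = 1 iff (γ(x) = 1 or g = 1) and (δ(y) = 1 or d = 1). If the one-literal condition (v_{p+q+2} = 1) is a ⊆-minimal global necessary reason for class 1 w.r.t. M, then γ is satisfiable (there exists x with γ(x) = 1) and δ is unsatisfiable (δ(y) = 0 for all y). Moreover: if δ is satisfiable then (v_{p+q+2} = 1) is not a global necessary reason for class 1 w.r.t. M, and if both γ and δ are unsatisfiable then (v_{p+q+2} = 1) is a global necessary reason for class 1 w.r.t. M that is not ⊆-minimal, witnessed by the literal (v_{p+q+1} = 1) being a global necessary reason not entailed by (v_{p+q+2} = 1). -/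

import Mathlib

/-- An n-instance: a binary vector of length n. -/
abbrev Inst (n : ℕ) := Fin n → Bool

/-- Terms: constants 0/1 or feature variables v_i. -/
inductive Term (n : ℕ) : Type where
  | const : Bool → Term n
  | var : Fin n → Term n
  deriving DecidableEq

/-- A literal t ◊ t' with ◊ ∈ {=, ≠} (isEq = true means `=`). -/
structure Lit (n : ℕ) : Type where
  isEq : Bool
  lhs : Term n
  rhs : Term n
  deriving DecidableEq

def Term.eval {n : ℕ} (x : Inst n) : Term n → Bool
  | .const b => b
  | .var i => x i

/-- Satisfaction of a literal by an instance. -/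
def Lit.sat {n : ℕ} (x : Inst n) (ℓ : Lit n) : Prop :=
  if ℓ.isEq then ℓ.lhs.eval x = ℓ.rhs.eval x else ℓ.lhs.eval x ≠ ℓ.rhs.eval x

/-- A condition: a finite conjunction of literals. -/
abbrev Cond (n : ℕ) := List (Lit n)

/-- Models of a condition. -/
def Mods {n : ℕ} (φ : Cond n) : Set (Inst n) := {x | ∀ ℓ ∈ φ, ℓ.sat x}

/-- Models of a single literal. -/
def ModsL {n : ℕ} (ℓ : Lit n) : Set (Inst n) := {x | ℓ.sat x}

/-- Instances classified with class c by classifier M. -/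
def ModsM {n : ℕ} (M : Inst n → Bool) (c : Bool) : Set (Inst n) := {x | M x = c}

/-- A condition entails a literal. -/
def Entails {n : ℕ} (φ : Cond n) (ℓ : Lit n) : Prop := Mods φ ⊆ ModsL ℓ

/-- φ is a global necessary reason for class c w.r.t. classifier M. -/
def GNR {n : ℕ} (M : Inst n → Bool) (c : Bool) (φ : Cond n) : Prop :=
  ModsM M c ⊆ Mods φ

/-- The classifier z = (x, y, g, d) ↦ (γ(x) ∨ g) ∧ (δ(y) ∨ d), where x are the first p
features, y the next q features, g is feature p+q+1 and d is feature p+q+2. -/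
def mkM (p q : ℕ) (γ : (Fin p → Bool) → Bool) (δ : (Fin q → Bool) → Bool) :
    Inst (p + q + 2) → Bool := fun z =>
  ((γ (fun i => z (Fin.castLE (by omega) i)) || z ⟨p + q, by omega⟩) &&
   (δ (fun j => z (Fin.castLE (by omega) (Fin.natAdd p j))) || z ⟨p + q + 1, by omega⟩))

/-- The literal (v_{p+q+2} = 1). -/
def dLit (p q : ℕ) : Lit (p + q + 2) :=
  ⟨true, Term.var ⟨p + q + 1, by omega⟩, Term.const true⟩

/-- The literal (v_{p+q+1} = 1). -/
def gLit (p q : ℕ) : Lit (p + q + 2) :=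
  ⟨true, Term.var ⟨p + q, by omega⟩, Term.const true⟩

theorem mem_Mods_dLit {p q : ℕ} (z : Inst (p + q + 2)) :
    z ∈ Mods [dLit p q] ↔ z ⟨p + q + 1, by omega⟩ = true := by
  simp [Mods, dLit, Lit.sat, Term.eval]

theorem mem_Mods_gLit {p q : ℕ} (z : Inst (p + q + 2)) :
    z ∈ Mods [gLit p q] ↔ z ⟨p + q, by omega⟩ = true := by
  simp [Mods, gLit, Lit.sat, Term.eval]

theorem not_GNR_dLit_of_sat {p q : ℕ} {γ : (Fin p → Bool) → Bool} {δ : (Fin q → Bool) → Bool}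
    (h : ∃ y, δ y = true) : ¬ GNR (mkM p q γ δ) true [dLit p q] := by
  obtain ⟨y, hy⟩ := h
  intro hG
  let z : Inst (p + q + 2) := fun i =>
    if h : p ≤ i.val ∧ i.val < p + q then y ⟨i.val - p, by omega⟩ else decide (i.val = p + q)
  have hz : z ∈ ModsM (mkM p q γ δ) true := by
    have hzy : (fun j => z (Fin.castLE (by omega) (Fin.natAdd p j))) = y := by
      funext j
      simp [z]
    have hzg : z ⟨p + q, by omega⟩ = true := by simp [z]
    simp only [ModsM, mkM, Set.mem_ofPred_eq, hzy, hzg, hy, Bool.or_true, Bool.true_or,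
      Bool.and_true]
  have hzd := (mem_Mods_dLit z).1 (hG hz)
  simp [z] at hzd

theorem GNR_dLit_of_unsat {p q : ℕ} {γ : (Fin p → Bool) → Bool} {δ : (Fin q → Bool) → Bool}
    (h : ∀ y, δ y = false) : GNR (mkM p q γ δ) true [dLit p q] := by
  intro z hz
  simp only [ModsM, mkM, Set.mem_ofPred_eq, h, Bool.false_or, Bool.and_eq_true] at hz
  exact (mem_Mods_dLit z).2 hz.2

theorem GNR_gLit_of_unsat {p q : ℕ} {γ : (Fin p → Bool) → Bool} {δ : (Fin q → Bool) → Bool}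
    (h : ∀ x, γ x = false) : GNR (mkM p q γ δ) true [gLit p q] := by
  intro z hz
  simp only [ModsM, mkM, Set.mem_ofPred_eq, h, Bool.false_or, Bool.and_eq_true] at hz
  exact (mem_Mods_gLit z).2 hz.1

theorem not_Entails_dLit_gLit (p q : ℕ) : ¬ Entails [dLit p q] (gLit p q) := by
  intro h
  have hz := h ((mem_Mods_dLit (fun i => decide (i.val = p + q + 1))).2 (by simp))
  simp [ModsL, gLit, Lit.sat, Term.eval] at hz

theorem exists_GNR_ssubset_dLit {p q : ℕ} {γ : (Fin p → Bool) → Bool}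
    {δ : (Fin q → Bool) → Bool} (hγ : ∀ x, γ x = false)
    (hG : GNR (mkM p q γ δ) true [dLit p q]) :
    ∃ ψ : Cond (p + q + 2), GNR (mkM p q γ δ) true ψ ∧ Mods ψ ⊂ Mods [dLit p q] := by
  refine ⟨[dLit p q, gLit p q], fun z hz ℓ hℓ => ?_, fun z hz ℓ hℓ => hz ℓ ?_, fun h => ?_⟩
  · rcases List.mem_cons.1 hℓ with rfl | hℓ
    · exact hG hz _ (by simp)
    · exact GNR_gLit_of_unsat hγ hz ℓ hℓ
  · exact List.mem_cons.2 (Or.inl (List.mem_singleton.1 hℓ))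
  · exact not_Entails_dLit_gLit p q fun z hz => h hz (gLit p q) (by simp)

/-- Converse direction of the Sat-UnSat reduction: if (v_{p+q+2} = 1) is a ⊆-minimal
global necessary reason for class 1 w.r.t. M then γ is satisfiable and δ is unsatisfiable.
Moreover, if δ is satisfiable then (v_{p+q+2} = 1) is not a global necessary reason, and
if both γ and δ are unsatisfiable then it is a global necessary reason that is not
⊆-minimal, witnessed by (v_{p+q+1} = 1) being a global necessary reason not entailed
by (v_{p+q+2} = 1). -/
theorem stmt17 (p q : ℕ) (hp : 1 ≤ p) (hq : 1 ≤ q)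
    (γ : (Fin p → Bool) → Bool) (δ : (Fin q → Bool) → Bool) :
    ((GNR (mkM p q γ δ) true [dLit p q] ∧
      (¬ ∃ ψ : Cond (p + q + 2), GNR (mkM p q γ δ) true ψ ∧
          Mods ψ ⊂ Mods [dLit p q])) →
      (∃ x, γ x = true) ∧ (∀ y, δ y = false)) ∧
    ((∃ y, δ y = true) → ¬ GNR (mkM p q γ δ) true [dLit p q]) ∧
    (((∀ x, γ x = false) ∧ (∀ y, δ y = false)) →
      GNR (mkM p q γ δ) true [dLit p q] ∧
      GNR (mkM p q γ δ) true [gLit p q] ∧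
      ¬ Entails [dLit p q] (gLit p q) ∧
      (∃ ψ : Cond (p + q + 2), GNR (mkM p q γ δ) true ψ ∧
          Mods ψ ⊂ Mods [dLit p q])) := by
  refine ⟨fun ⟨hG, hmin⟩ => ⟨?_, fun y => ?_⟩, not_GNR_dLit_of_sat, fun ⟨hγ, hδ⟩ =>
    ⟨GNR_dLit_of_unsat hδ, GNR_gLit_of_unsat hγ, not_Entails_dLit_gLit p q,
      exists_GNR_ssubset_dLit hγ (GNR_dLit_of_unsat hδ)⟩⟩
  · by_contra hγ
    exact hmin (exists_GNR_ssubset_dLit (fun x => by simpa using not_exists.1 hγ x) hG)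
  · by_contra hy
    exact not_GNR_dLit_of_sat ⟨y, by simpa using hy⟩ hG
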